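/- Let α be a finite alphabet with at least two distinct letters. Then the free monoid on α is affine complete: for every n and every congruence preserving function f : (Fin n → FreeMonoid α) → FreeMonoid α there exists a word P ∈ FreeMonoid (α ⊕ Fin n) such that for all u : Fin n → FreeMonoid α, f u equals the image of P under the monoid homomorphism sending each letter Sum.inl c to the one-letter word c and each variable Sum.inr i to u i. -/

import Mathlib

/-- `f` is congruence preserving on the free monoid. -/
def IsCP {α : Type*} {n : ℕ} (f : (Fin n → FreeMonoid α) → FreeMonoid α) : Prop :=
  ∀ c : Con (FreeMonoid α), ∀ u v : Fin n → FreeMonoid α,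
    (∀ i, c (u i) (v i)) → c (f u) (f v)

/-- One rewriting step: a factor `U i` is replaced by `V i`. -/
def RewriteStep {M ι : Type*} [Mul M] (U V : ι → M) (w w' : M) : Prop :=
  ∃ x i y, w = x * U i * y ∧ w' = x * V i * y

/-- No two distinct occurrences of words of the family `U` overlap. -/
def NonOverlapping {M ι : Type*} [Mul M] (U : ι → M) : Prop :=
  ∀ x i y x' j y', x * U i * y = x' * U j * y' →
    (i = j ∧ x = x' ∧ y = y') ∨
    (∃ z, x' = x * U i * z ∧ y = z * U j * y') ∨
    (∃ z, x = x' * U j * z ∧ y' = z * U i * y)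

/-- No word of the family `U` occurs in `w`. -/
def AvoidsFactors {M ι : Type*} [Mul M] (U : ι → M) (w : M) : Prop :=
  ∀ x i y, w ≠ x * U i * y

section Rewriting

variable {M ι : Type*} [Monoid M] {U : ι → M}

theorem RewriteStep.mul_left {V : ι → M} {w w' : M} (s : M) (h : RewriteStep U V w w') :
    RewriteStep U V (s * w) (s * w') := by
  obtain ⟨x, i, y, rfl, rfl⟩ := h
  exact ⟨s * x, i, y, by simp only [mul_assoc], by simp only [mul_assoc]⟩

theorem RewriteStep.mul_right {V : ι → M} {w w' : M} (s : M) (h : RewriteStep U V w w') :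
    RewriteStep U V (w * s) (w' * s) := by
  obtain ⟨x, i, y, rfl, rfl⟩ := h
  exact ⟨x, i, y * s, by simp only [mul_assoc], by simp only [mul_assoc]⟩

theorem NonOverlapping.diamond (hU : NonOverlapping U) (V : ι → M) (p q r : M)
    (hq : RewriteStep U V p q) (hr : RewriteStep U V p r) :
    ∃ d, Relation.ReflGen (RewriteStep U V) q d ∧
      Relation.ReflTransGen (RewriteStep U V) r d := by
  obtain ⟨x, i, y, rfl, rfl⟩ := hq
  obtain ⟨x', j, y', h, rfl⟩ := hr
  rcases hU _ _ _ _ _ _ h with ⟨rfl, rfl, rfl⟩ | ⟨z, rfl, rfl⟩ | ⟨z, rfl, rfl⟩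
  · exact ⟨_, .refl, .refl⟩
  · exact ⟨x * V i * z * V j * y',
      .single ⟨x * V i * z, j, y', by simp only [mul_assoc], rfl⟩,
      .single ⟨x, i, z * V j * y', by simp only [mul_assoc], by simp only [mul_assoc]⟩⟩
  · exact ⟨x' * V j * z * V i * y,
      .single ⟨x', j, z * V i * y, by simp only [mul_assoc], by simp only [mul_assoc]⟩,
      .single ⟨x' * V j * z, i, y, by simp only [mul_assoc], rfl⟩⟩

theorem AvoidsFactors.eq_of_reflTransGen {V : ι → M} {w w' : M} (hw : AvoidsFactors U w)
    (h : Relation.ReflTransGen (RewriteStep U V) w w') : w = w' := by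
  rcases Relation.ReflTransGen.cases_head h with h | ⟨_, ⟨x, i, y, hx, _⟩, _⟩
  · exact h
  · exact absurd hx (hw x i y)

/-- A congruence identifying `U i` with `V i` which separates the words avoiding `U`. -/
theorem NonOverlapping.exists_con (hU : NonOverlapping U) (V : ι → M) :
    ∃ c : Con M, (∀ i, c (U i) (V i)) ∧
      ∀ w w', AvoidsFactors U w → AvoidsFactors U w' → c w w' → w = w' := by
  have heq := Relation.equivalence_join_reflTransGen (hU.diamond V)
  refine ⟨⟨⟨_, heq⟩, ?_⟩, fun i => ?_, ?_⟩
  · rintro w x y z ⟨d, hwd, hxd⟩ ⟨e, hye, hze⟩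
    refine ⟨d * e, ?_, ?_⟩
    · exact (hwd.lift (· * y) fun _ _ h => h.mul_right y).trans
        (hye.lift (d * ·) fun _ _ h => h.mul_left d)
    · exact (hxd.lift (· * z) fun _ _ h => h.mul_right z).trans
        (hze.lift (d * ·) fun _ _ h => h.mul_left d)
  · exact ⟨V i, .single ⟨1, i, 1, by simp, by simp⟩, .refl⟩
  · rintro w w' hw hw' ⟨d, hd, hd'⟩
    rw [hw.eq_of_reflTransGen hd, hw'.eq_of_reflTransGen hd']

end Rewriting

/-- The polynomial function of the word `P`. -/
abbrev polyEval {α : Type*} {n : ℕ} (P : FreeMonoid (α ⊕ Fin n)) (u : Fin n → FreeMonoid α) :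
    FreeMonoid α :=
  FreeMonoid.lift (Sum.elim FreeMonoid.of u) P

section Polynomial

variable {α : Type*} {n : ℕ}

theorem isCP_polyEval (P : FreeMonoid (α ⊕ Fin n)) : IsCP (polyEval P) := by
  intro c u v h
  induction P using FreeMonoid.inductionOn' with
  | one => simpa [polyEval] using c.refl 1
  | of_mul x P ih =>
    simp only [polyEval, map_mul, FreeMonoid.lift_eval_of] at ih ⊢
    refine c.mul ?_ ih
    cases x with
    | inl x => exact c.refl _
    | inr i => exact h i

theorem polyEval_map_inl (w : FreeMonoid α) (u : Fin n → FreeMonoid α) :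
    polyEval (FreeMonoid.map Sum.inl w) u = w := by
  induction w using FreeMonoid.inductionOn' with
  | one => rfl
  | of_mul x w ih =>
    simp only [polyEval, map_mul, FreeMonoid.map_of, FreeMonoid.lift_eval_of] at ih ⊢
    rw [ih]; rfl

theorem polyEval_eq_of_avoidsFactors {f : (Fin n → FreeMonoid α) → FreeMonoid α} (hf : IsCP f)
    {U V : Fin n → FreeMonoid α} (hU : NonOverlapping U) {P : FreeMonoid (α ⊕ Fin n)}
    (hP : polyEval P U = f U) (h₁ : AvoidsFactors U (f V)) (h₂ : AvoidsFactors U (polyEval P V)) :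
    polyEval P V = f V := by
  obtain ⟨c, hc, hsep⟩ := hU.exists_con V
  refine (hsep _ _ h₁ h₂ ?_).symm
  have h := isCP_polyEval P c U V hc
  rw [hP] at h
  exact c.trans (c.symm (hf c U V hc)) h

theorem length_le_length_polyEval (P : FreeMonoid (α ⊕ Fin n)) (u : Fin n → FreeMonoid α)
    (hu : ∀ i, 1 ≤ (u i).length) : P.length ≤ (polyEval P u).length := by
  induction P using FreeMonoid.inductionOn' with
  | one => simp
  | of_mul x P ih =>
    simp only [polyEval, map_mul, FreeMonoid.lift_eval_of, FreeMonoid.length_mul,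
      FreeMonoid.length_of] at ih ⊢
    refine Nat.add_le_add ?_ ih
    cases x with
    | inl x => simp
    | inr i => exact hu i

theorem AvoidsFactors.of_length_lt {ι : Type*} {U : ι → FreeMonoid α} {w : FreeMonoid α}
    (h : ∀ i, w.length < (U i).length) : AvoidsFactors U w := by
  rintro x i y rfl
  have := h i
  simp only [FreeMonoid.length_mul] at this
  omega

/-- A shortest polynomial with a given value at `U` contains no word of `U` as a block of
constants. -/
theorem exists_polyEval_eq_of_two_le_length (U : Fin n → FreeMonoid α)
    (hU : ∀ i, 2 ≤ (U i).length) (w : FreeMonoid α) :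
    ∃ P : FreeMonoid (α ⊕ Fin n), polyEval P U = w ∧
      AvoidsFactors (fun i => FreeMonoid.map Sum.inl (U i)) P := by
  classical
  obtain ⟨P, hP, hmin⟩ := exists_minimalFor_of_wellFoundedLT
    (fun P : FreeMonoid (α ⊕ Fin n) => polyEval P U = w) FreeMonoid.length
    ⟨_, polyEval_map_inl w U⟩
  refine ⟨P, hP, ?_⟩
  rintro x i y rfl
  have key := hmin (j := x * FreeMonoid.of (Sum.inr i) * y) (by
    have := polyEval_map_inl (n := n) (U i) U
    simp only [polyEval, map_mul, FreeMonoid.lift_eval_of, Sum.elim_inr] at this hP ⊢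
    rw [← hP, this])
  have hlen : (FreeMonoid.map (Sum.inl : α → α ⊕ Fin n) (U i)).length = (U i).length :=
    List.length_map ..
  simp only [FreeMonoid.length_mul, FreeMonoid.length_of, hlen] at key
  have := hU i
  omega

end Polynomial

section Marker

variable {α : Type*} (a b : α)

/-- The word `(ba)ᵏbb`. -/
def markerTail : ℕ → List α
  | 0 => [b, b]
  | k + 1 => b :: a :: markerTail k

/-- The word `aa(ba)ᵏbb`. -/
def marker (k : ℕ) : List α := a :: a :: markerTail a b k

variable {a b}

theorem markerTail_eq_cons (k : ℕ) : ∃ t, markerTail a b k = b :: t := by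
  cases k <;> exact ⟨_, rfl⟩

theorem le_length_marker (k : ℕ) : k + 2 ≤ (marker a b k).length := by
  have : k ≤ (markerTail a b k).length := by
    induction k with
    | zero => exact Nat.zero_le _
    | succ k ih => simp only [markerTail, List.length_cons]; omega
  simp only [marker, List.length_cons]
  omega

theorem markerTail_suffix_append_ne (hab : a ≠ b) {k : ℕ} {W y z : List α}
    (hW : W <:+ markerTail a b k) (hne : W ≠ []) : W ++ y ≠ a :: a :: z := by
  induction k with
  | zero =>
    intro h
    simp only [markerTail, List.suffix_cons_iff, List.suffix_nil] at hW
    rcases hW with rfl | rfl | rfl <;> simp_all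
  | succ k ih =>
    simp only [markerTail, List.suffix_cons_iff] at hW
    rcases hW with rfl | rfl | hW
    · intro h
      simp_all
    · obtain ⟨t, ht⟩ := markerTail_eq_cons (a := a) (b := b) k
      intro h
      simp_all
    · exact ih hW

theorem eq_marker_of_suffix (hab : a ≠ b) {k : ℕ} {W y z : List α}
    (hW : W <:+ marker a b k) (hne : W ≠ []) (h : W ++ y = a :: a :: z) : W = marker a b k := by
  simp only [marker, List.suffix_cons_iff] at hW
  rcases hW with rfl | rfl | hW
  · rfl
  · obtain ⟨t, ht⟩ := markerTail_eq_cons (a := a) (b := b) k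
    simp_all
  · exact absurd h (markerTail_suffix_append_ne hab hW hne)

theorem markerTail_append_inj (hab : a ≠ b) {k l : ℕ} {y z : List α}
    (h : markerTail a b k ++ y = markerTail a b l ++ z) : k = l := by
  induction k generalizing l with
  | zero => cases l <;> simp_all [markerTail, eq_comm]
  | succ k ih =>
    cases l with
    | zero => simp_all [markerTail]
    | succ l =>
      simp only [markerTail, List.cons_append, List.cons.injEq, true_and] at h
      rw [ih h]

theorem marker_append_inj (hab : a ≠ b) {k l : ℕ} {y z : List α}
    (h : marker a b k ++ y = marker a b l ++ z) : k = l := by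
  simp only [marker, List.cons_append, List.cons.injEq, true_and] at h
  exact markerTail_append_inj hab h

/-- Either the second of two occurrences of markers starts after the end of the first,
or they coincide. -/
theorem marker_append_eq (hab : a ≠ b) {k l : ℕ} {y y' z : List α}
    (h : marker a b k ++ y = z ++ (marker a b l ++ y')) :
    (z = [] ∧ k = l ∧ y = y') ∨ ∃ t, z = marker a b k ++ t ∧ y = t ++ (marker a b l ++ y') := by
  rcases List.append_eq_append_iff.1 h with ⟨t, rfl, ht⟩ | ⟨t, ht, h'⟩
  · exact .inr ⟨t, rfl, ht⟩
  · by_cases hne : t = []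
    · subst hne
      exact .inr ⟨[], by simpa using ht.symm, by simpa using h'.symm⟩
    · have := eq_marker_of_suffix hab ⟨z, ht.symm⟩ hne h'.symm
      subst this
      have hz : z = [] := by simpa using ht
      subst hz
      obtain rfl := marker_append_inj hab h
      exact .inl ⟨rfl, rfl, by simpa using h⟩

theorem nonOverlapping_marker (hab : a ≠ b) {ι : Type*} {k : ι → ℕ}
    (hk : Function.Injective k) :
    NonOverlapping fun i => FreeMonoid.ofList (marker a b (k i)) := by
  intro x i y x' j y' h
  have h' : x.toList ++ (marker a b (k i) ++ y.toList) =
      x'.toList ++ (marker a b (k j) ++ y'.toList) := by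
    simpa [FreeMonoid.toList_mul] using congrArg FreeMonoid.toList h
  rcases List.append_eq_append_iff.1 h' with ⟨z, hz, hz'⟩ | ⟨z, hz, hz'⟩
  · rcases marker_append_eq hab hz' with ⟨rfl, hij, hy⟩ | ⟨t, rfl, hy⟩
    · exact .inl ⟨hk hij, by simpa using hz.symm, hy⟩
    · refine .inr (.inl ⟨FreeMonoid.ofList t, ?_, ?_⟩) <;> apply FreeMonoid.toList.injective <;>
        simp [FreeMonoid.toList_mul, hz, hy]
  · rcases marker_append_eq hab hz' with ⟨rfl, hij, hy⟩ | ⟨t, rfl, hy⟩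
    · exact .inl ⟨(hk hij).symm, by simpa using hz, hy.symm⟩
    · refine .inr (.inr ⟨FreeMonoid.ofList t, ?_, ?_⟩) <;> apply FreeMonoid.toList.injective <;>
        simp [FreeMonoid.toList_mul, hz, hy]

/-- The word `aaabbb`, which overlaps no marker of positive index. -/
def separator (a b : α) : List α := [a, a, a, b, b, b]

variable {n : ℕ}

theorem polyEval_separator_inl (x : α) (P : List (α ⊕ Fin n)) :
    (polyEval (FreeMonoid.ofList (Sum.inl x :: P))
      fun _ => FreeMonoid.ofList (separator a b)).toList =
    x :: (polyEval (FreeMonoid.ofList P) fun _ => FreeMonoid.ofList (separator a b)).toList := by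
  simp [polyEval, FreeMonoid.ofList_cons, FreeMonoid.toList_mul]

theorem polyEval_separator_inr (i : Fin n) (P : List (α ⊕ Fin n)) :
    (polyEval (FreeMonoid.ofList (Sum.inr i :: P))
      fun _ => FreeMonoid.ofList (separator a b)).toList =
    separator a b ++
      (polyEval (FreeMonoid.ofList P) fun _ => FreeMonoid.ofList (separator a b)).toList := by
  simp [polyEval, FreeMonoid.ofList_cons, FreeMonoid.toList_mul]

theorem isPrefix_of_polyEval_separator_eq (hab : a ≠ b) {k : ℕ} (P : List (α ⊕ Fin n))
    {W y : List α} (hW : W <:+ marker a b k)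
    (h : (polyEval (FreeMonoid.ofList P)
      fun _ => FreeMonoid.ofList (separator a b)).toList = W ++ y) :
    W.map Sum.inl <+: P := by
  induction P generalizing W with
  | nil =>
    have : W ++ y = [] := by simpa [polyEval] using h.symm
    simp_all
  | cons p P ih =>
    cases W with
    | nil => simp
    | cons w W =>
      cases p with
      | inl x =>
        rw [polyEval_separator_inl] at h
        simp only [List.cons_append, List.cons.injEq] at h
        obtain ⟨rfl, h⟩ := h
        have := ih ((List.suffix_cons _ _).trans hW) h
        simpa using this
      | inr i =>
        rw [polyEval_separator_inr] at h
        have hW' := eq_marker_of_suffix hab hW (by simp) h.symm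
        obtain ⟨t, ht⟩ := markerTail_eq_cons (a := a) (b := b) k
        rw [hW'] at h
        simp_all [marker, separator]

theorem isInfix_of_polyEval_separator_eq (hab : a ≠ b) {k : ℕ} (P : List (α ⊕ Fin n))
    {x y : List α}
    (h : (polyEval (FreeMonoid.ofList P)
      fun _ => FreeMonoid.ofList (separator a b)).toList = x ++ (marker a b (k + 1) ++ y)) :
    (marker a b (k + 1)).map Sum.inl <:+: P := by
  induction P generalizing x with
  | nil =>
    have : x ++ (marker a b (k + 1) ++ y) = [] := by simpa [polyEval] using h.symm
    simp [marker] at this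
  | cons p P ih =>
    cases p with
    | inl c =>
      cases x with
      | nil =>
        exact (isPrefix_of_polyEval_separator_eq hab _ (List.suffix_refl _) h).isInfix
      | cons d x =>
        rw [polyEval_separator_inl] at h
        simp only [List.cons_append, List.cons.injEq] at h
        exact (ih h.2).trans (List.suffix_cons _ _).isInfix
    | inr i =>
      rw [polyEval_separator_inr] at h
      rcases List.append_eq_append_iff.1 h with ⟨t, rfl, ht⟩ | ⟨t, ht, h'⟩
      · exact (ih ht).trans (List.suffix_cons _ _).isInfix
      · by_cases hne : t = []
        · subst hne
          exact (ih (x := []) (by simpa using h'.symm)).trans (List.suffix_cons _ _).isInfix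
        · exfalso
          have hs : t <:+ separator a b := ⟨x, ht.symm⟩
          simp only [separator, List.suffix_cons_iff, List.suffix_nil] at hs
          rcases hs with rfl | rfl | rfl | rfl | rfl | rfl | rfl <;>
            simp_all [marker, markerTail, eq_comm]

theorem avoidsFactors_polyEval_separator (hab : a ≠ b) {k : Fin n → ℕ}
    {P : FreeMonoid (α ⊕ Fin n)}
    (hP : AvoidsFactors
      (fun i => FreeMonoid.map Sum.inl (FreeMonoid.ofList (marker a b (k i + 1)))) P) :
    AvoidsFactors (fun i => FreeMonoid.ofList (marker a b (k i + 1)))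
      (polyEval P fun _ => FreeMonoid.ofList (separator a b)) := by
  intro x i y h
  obtain ⟨s, t, hst⟩ := isInfix_of_polyEval_separator_eq hab P.toList (k := k i)
    (x := x.toList) (y := y.toList)
    (by simpa [FreeMonoid.toList_mul] using congrArg FreeMonoid.toList h)
  exact hP (FreeMonoid.ofList s) i (FreeMonoid.ofList t) hst.symm

end Marker

/-- The free monoid on a finite alphabet with at least two letters is affine complete. -/
theorem freeMonoid_affineComplete {α : Type*} [Fintype α] (a b : α) (hab : a ≠ b)
    (n : ℕ) (f : (Fin n → FreeMonoid α) → FreeMonoid α) (hf : IsCP f) :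
    ∃ P : FreeMonoid (α ⊕ Fin n), ∀ u : Fin n → FreeMonoid α,
      f u = FreeMonoid.lift (Sum.elim FreeMonoid.of u) P := by
  set U : ℕ → Fin n → FreeMonoid α :=
    fun L i => FreeMonoid.ofList (marker a b (L + i + 1))
  set V₀ : Fin n → FreeMonoid α := fun _ => FreeMonoid.ofList (separator a b) with hV₀
  set B := (f V₀).length with hB
  have hlen : ∀ L i, L + 2 ≤ (U L i).length := fun L i =>
    (by omega : L + 2 ≤ L + i + 1 + 2).trans (le_length_marker _)
  have hU : ∀ L, NonOverlapping (U L) := fun L =>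
    nonOverlapping_marker (k := fun i : Fin n => L + i + 1) hab fun i j h => by
      apply Fin.ext
      simp only at h
      omega
  have hbound : ∀ L, ∃ P : FreeMonoid (α ⊕ Fin n), P.length ≤ B ∧
      polyEval P (U (B + L)) = f (U (B + L)) := by
    intro L
    obtain ⟨P, hP, hav⟩ := exists_polyEval_eq_of_two_le_length (U (B + L))
      (fun i => by have := hlen (B + L) i; omega) (f (U (B + L)))
    have hV : polyEval P V₀ = f V₀ := polyEval_eq_of_avoidsFactors hf (hU _) hP
      (.of_length_lt fun i => by have := hlen (B + L) i; omega)
      (avoidsFactors_polyEval_separator (k := fun i => B + L + i) hab hav)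
    refine ⟨P, ?_, hP⟩
    rw [hB, ← hV]
    exact length_le_length_polyEval P V₀ fun _ => by
      simp [hV₀, separator, FreeMonoid.length]
  choose g hgB hgU using hbound
  have hfin : Finite {P : FreeMonoid (α ⊕ Fin n) // P.length ≤ B} :=
    (List.finite_length_le (α ⊕ Fin n) B).to_subtype
  obtain ⟨P, hinf⟩ := Finite.exists_infinite_fiber
    (fun L => (⟨g L, hgB L⟩ : {P : FreeMonoid (α ⊕ Fin n) // P.length ≤ B}))
  refine ⟨P.1, fun u => ?_⟩
  obtain ⟨L, hL, hlt⟩ := (Set.infinite_coe_iff.1 hinf).exists_gt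
    ((f u).length + (polyEval P.1 u).length)
  have hLP : g L = P.1 := congrArg Subtype.val hL
  refine (polyEval_eq_of_avoidsFactors hf (hU (B + L)) (hLP ▸ hgU L)
    (.of_length_lt fun i => ?_) (.of_length_lt fun i => ?_)).symm <;>
  · have := hlen (B + L) i
    omega
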